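/- arXiv:2212.08398 — 2 statements merged into one kernel-verified Lean document; each statement's English description precedes it below -/
import Mathlib

section
/- Let K ≥ 1 and let q, p : ℤ/Kℤ → ℝ² be two closed polygons with vertices indexed modulo K. For each k and t ∈ [0,1] set v_k(t) := (1 − t)·q_k + t·p_k. Then Σ_{k=0}^{K−1} ∫_0^1 ½ ⟪(p_k − q_k) + (p_{k+1} − q_{k+1}), R(v_{k+1}(t) − v_k(t))⟫ dt = A(p) − A(q), where R(x₁, x₂) := (x₂, −x₁) and A(r) := ½ Σ_{k=0}^{K−1} (r_k × r_{k+1}) with a × b := a₁b₂ − a₂b₁. -/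
/-- Scalar cross product in ℝ²: `a × b = a₁b₂ − a₂b₁`. -/
def cross2 (a b : ℝ × ℝ) : ℝ := a.1 * b.2 - a.2 * b.1

/-- Rotation by `−π/2` in ℝ²: `R(x₁, x₂) = (x₂, −x₁)`. -/
def rot2 (x : ℝ × ℝ) : ℝ × ℝ := (x.2, -x.1)

/-- Euclidean inner product on ℝ². -/
def dot2 (a b : ℝ × ℝ) : ℝ := a.1 * b.1 + a.2 * b.2

/-- Signed (shoelace) area enclosed by a closed polygon with vertices indexed by `ZMod K`. -/
noncomputable def shoelace (K : ℕ) [NeZero K] (r : ZMod K → ℝ × ℝ) : ℝ :=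
  (1 / 2) * ∑ k : ZMod K, cross2 (r k) (r (k + 1))

/-- Two-dimensional case of the exact volume-update identity (Lemma 3.1, eq. (3.11a)):
for two closed polygons `q, p` with vertices indexed modulo `K` and the linear
interpolation `v_k(t) = (1−t)·q_k + t·p_k`, the mass-lumped integral of the vertex
displacements against the time-weighted edge normals equals the change of enclosed
signed area. -/
theorem stmt6 (K : ℕ) [NeZero K] (hK : 1 ≤ K) (q p : ZMod K → ℝ × ℝ)
    (v : ZMod K → ℝ → ℝ × ℝ) (hv : ∀ k t, v k t = (1 - t) • q k + t • p k) :
    (∑ k : ZMod K, ∫ t in (0:ℝ)..1,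
        (1 / 2) * dot2 ((p k - q k) + (p (k + 1) - q (k + 1)))
          (rot2 (v (k + 1) t - v k t))) =
      shoelace K p - shoelace K q := by
  have hlin : ∀ a b : ℝ, ∫ t in (0:ℝ)..1, (a + b * t) = a + b / 2 := by
    intro a b
    rw [intervalIntegral.integral_add (by simp) (by apply Continuous.intervalIntegrable; fun_prop),
      intervalIntegral.integral_const_mul, integral_id]
    simp
    ring
  have key : ∀ k : ZMod K, (∫ t in (0:ℝ)..1,
        (1 / 2) * dot2 ((p k - q k) + (p (k + 1) - q (k + 1)))
          (rot2 (v (k + 1) t - v k t))) =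
      ((1 / 2) * cross2 (p k) (p (k + 1)) - (1 / 2) * cross2 (q k) (q (k + 1))) +
        ((1 / 2) * cross2 (p (k + 1)) (q (k + 1)) - (1 / 2) * cross2 (p k) (q k)) := by
    intro k
    have h : ∀ t : ℝ, (1 / 2) * dot2 ((p k - q k) + (p (k + 1) - q (k + 1)))
          (rot2 (v (k + 1) t - v k t)) =
        (1 / 2) * cross2 ((p k - q k) + (p (k + 1) - q (k + 1))) (q (k + 1) - q k) +
        (1 / 2) * cross2 ((p k - q k) + (p (k + 1) - q (k + 1)))
          ((p (k + 1) - q (k + 1)) - (p k - q k)) * t := by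
      intro t
      simp only [hv, dot2, rot2, cross2, Prod.fst_add, Prod.snd_add, Prod.fst_sub, Prod.snd_sub,
        Prod.smul_fst, Prod.smul_snd, smul_eq_mul]
      ring
    simp only [h]
    rw [hlin]
    simp only [cross2, Prod.fst_add, Prod.snd_add, Prod.fst_sub, Prod.snd_sub]
    ring
  have htel : ∑ k : ZMod K, (1 / 2) * cross2 (p (k + 1)) (q (k + 1)) =
      ∑ k : ZMod K, (1 / 2) * cross2 (p k) (q k) :=
    Equiv.sum_comp (Equiv.addRight (1 : ZMod K)) (fun k => (1 / 2) * cross2 (p k) (q k))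
  simp only [key]
  rw [Finset.sum_add_distrib, Finset.sum_sub_distrib, Finset.sum_sub_distrib, htel, sub_self,
    add_zero, shoelace, shoelace, Finset.mul_sum, Finset.mul_sum]
end

section
/- Let q₀, q₁, p₀, p₁ ∈ ℝ² and for t ∈ [0,1] set v_k(t) := (1 − t)·q_k + t·p_k for k = 0, 1. Then ∫_0^1 ½ ⟪(p₀ − q₀) + (p₁ − q₁), R(v₁(t) − v₀(t))⟫ dt = ½ (q₀ × p₀ + p₀ × p₁ + p₁ × q₁ + q₁ × q₀), where R(x₁, x₂) := (x₂, −x₁) and a × b := a₁b₂ − a₂b₁; that is, the left-hand side equals the signed (shoelace) area of the quadrilateral with ordered vertices (q₀, p₀, p₁, q₁). -/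
/-- Single-edge version of the discrete volume-update identity (Lemma 3.1, eq. (3.11a))
in two dimensions: the mass-lumped displacement integrated against the time-weighted
edge normal equals the signed (shoelace) area of the quadrilateral `(q₀, p₀, p₁, q₁)`,
i.e. the signed area swept by the edge moving from `[q₀, q₁]` to `[p₀, p₁]` with
linearly interpolated vertices. -/
theorem stmt7 (q₀ q₁ p₀ p₁ : ℝ × ℝ) (v : Fin 2 → ℝ → ℝ × ℝ)
    (hv0 : ∀ t, v 0 t = (1 - t) • q₀ + t • p₀)
    (hv1 : ∀ t, v 1 t = (1 - t) • q₁ + t • p₁) :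
    (∫ t in (0:ℝ)..1,
        (1 / 2) * dot2 ((p₀ - q₀) + (p₁ - q₁)) (rot2 (v 1 t - v 0 t))) =
      (1 / 2) * (cross2 q₀ p₀ + cross2 p₀ p₁ + cross2 p₁ q₁ + cross2 q₁ q₀) := by
  have h : ∀ t : ℝ, (1 / 2) * dot2 ((p₀ - q₀) + (p₁ - q₁)) (rot2 (v 1 t - v 0 t)) =
      (1 / 2) * dot2 ((p₀ - q₀) + (p₁ - q₁)) (rot2 (q₁ - q₀)) +
      t * ((1 / 2) * dot2 ((p₀ - q₀) + (p₁ - q₁)) (rot2 ((p₁ - p₀) - (q₁ - q₀)))) := by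
    intro t
    rw [hv0, hv1]
    simp only [dot2, rot2, Prod.fst_add, Prod.snd_add, Prod.fst_sub, Prod.snd_sub,
      Prod.smul_fst, Prod.smul_snd, smul_eq_mul]
    ring
  simp_rw [h]
  rw [intervalIntegral.integral_add (Continuous.intervalIntegrable (by fun_prop) _ _)
    (Continuous.intervalIntegrable (by fun_prop) _ _),
    intervalIntegral.integral_const, intervalIntegral.integral_mul_const, integral_id]
  simp only [dot2, rot2, cross2, Prod.fst_add, Prod.snd_add, Prod.fst_sub, Prod.snd_sub,
    smul_eq_mul]
  ring
end
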